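/- Let n > q ≥ 2 be integers and let a > 1 be real. If f is holomorphic on V(a) = {(z,w) ∈ ℂ^{n−q} × ℂ^q : ‖z‖ < a, a^{−1} < ‖w‖ < a}, then there exists a function F holomorphic on the polydomain {(z,w) ∈ ℂ^{n−q} × ℂ^q : ‖z‖ < a, ‖w‖ < a} such that F = f on V(a). -/

import Mathlib

/-- The ambient space `ℂ^{n-q} × ℂ^q` with Euclidean norms on each factor. -/
abbrev Esp (n q : ℕ) := EuclideanSpace ℂ (Fin (n - q)) × EuclideanSpace ℂ (Fin q)

/-- The domain `V(a) = {(z,w) : ‖z‖ < a, a⁻¹ < ‖w‖ < a}`. -/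
def Vdom (n q : ℕ) (a : ℝ) : Set (Esp n q) :=
  {p | ‖p.1‖ < a ∧ a⁻¹ < ‖p.2‖ ∧ ‖p.2‖ < a}

open Complex Metric Set Filter Topology MeasureTheory

/-- A circle integral of a holomorphic function of `(x, ζ)` is holomorphic in the parameter `x`. -/
theorem differentiableAt_circleIntegral_of_differentiableOn
    {E : Type*} [NormedAddCommGroup E] [NormedSpace ℂ E] [FiniteDimensional ℂ E]
    {h : E × ℂ → ℂ} {U : Set (E × ℂ)} (hU : IsOpen U) (hh : DifferentiableOn ℂ h U)
    {x₀ : E} {c : ℂ} {r : ℝ} (hr : 0 ≤ r) (hK : ∀ ζ ∈ sphere c r, (x₀, ζ) ∈ U) :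
    DifferentiableAt ℂ (fun x => ∮ ζ in C(c, r), h (x, ζ)) x₀ := by
  borelize E
  have : ProperSpace E := FiniteDimensional.proper ℂ E
  have hKc : IsCompact ({x₀} ×ˢ sphere c r : Set (E × ℂ)) :=
    isCompact_singleton.prod (isCompact_sphere c r)
  have hKU : ({x₀} ×ˢ sphere c r : Set (E × ℂ)) ⊆ U := by
    rintro ⟨x, ζ⟩ ⟨hx, hζ⟩
    obtain rfl : x = x₀ := hx
    exact hK ζ hζ
  obtain ⟨δ, hδ, hδU⟩ := hKc.exists_cthickening_subset_open hU hKU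
  obtain ⟨M, hM⟩ := hKc.cthickening.exists_bound_of_continuousOn (hh.continuousOn.mono hδU)
  have hmem {x : E} (hx : x ∈ ball x₀ (δ / 2)) (t : ℝ) :
      ball (x, circleMap c r t) (δ / 2) ⊆ cthickening δ ({x₀} ×ˢ sphere c r) := by
    intro p hp
    refine mem_cthickening_of_dist_le p (x₀, circleMap c r t) δ _
      ⟨rfl, circleMap_mem_sphere c hr t⟩ ?_
    have h1 : dist (x, circleMap c r t) (x₀, circleMap c r t) < δ / 2 := by
      simpa [Prod.dist_eq, hδ] using hx
    linarith [dist_triangle p (x, circleMap c r t) (x₀, circleMap c r t), mem_ball.1 hp]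
  have hdiff {x : E} (hx : x ∈ ball x₀ (δ / 2)) (t : ℝ) :
      DifferentiableAt ℂ h (x, circleMap c r t) :=
    hh.differentiableAt (hU.mem_nhds (hδU (hmem hx t (mem_ball_self (by positivity)))))
  have hcont {x : E} (hx : x ∈ ball x₀ (δ / 2)) :
      Continuous fun t => deriv (circleMap c r) t • h (x, circleMap c r t) := by
    refine Continuous.smul (f := deriv (circleMap c r)) ?_ (continuous_iff_continuousAt.2 fun t => ?_)
    · simp only [funext (deriv_circleMap c r)]
      fun_prop
    · exact (hdiff hx t).continuousAt.comp (f := fun t => (x, circleMap c r t)) (by fun_prop)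
  refine (intervalIntegral.hasFDerivAt_integral_of_dominated_of_fderiv_le
    (F' := fun x t => deriv (circleMap c r) t •
      (fderiv ℂ h (x, circleMap c r t)).comp (ContinuousLinearMap.inl ℂ E ℂ))
    (bound := fun _ => r * (2 * M / (δ / 2)))
    (ball_mem_nhds x₀ (half_pos hδ)) ?_ ?_ ?_ ?_ ?_ ?_).differentiableAt
  · filter_upwards [ball_mem_nhds x₀ (half_pos hδ)] with x hx
    exact (hcont hx).aestronglyMeasurable
  · exact (hcont (mem_ball_self (half_pos hδ))).intervalIntegrable _ _
  · refine AEStronglyMeasurable.fun_smul ?_ ?_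
    · simp only [funext (deriv_circleMap c r)]
      exact Continuous.aestronglyMeasurable (by fun_prop)
    · have h1 : Measurable fun t : ℝ => fderiv ℂ h (x₀, circleMap c r t) :=
        (measurable_fderiv ℂ h).comp (by fun_prop)
      have h2 : Continuous fun L : E × ℂ →L[ℂ] ℂ => L.comp (ContinuousLinearMap.inl ℂ E ℂ) := by
        fun_prop
      exact h2.comp_aestronglyMeasurable h1.aestronglyMeasurable
  · refine .of_forall fun t _ x hx => ?_
    have h1 : ‖fderiv ℂ h (x, circleMap c r t)‖ ≤ 2 * M / (δ / 2) := by
      refine norm_fderiv_le_div_of_mapsTo_ball (hh.mono ((hmem hx t).trans hδU)) ?_ (by positivity)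
      intro p hp
      rw [mem_closedBall, dist_eq_norm]
      linarith [norm_sub_le (h p) (h (x, circleMap c r t)), hM p (hmem hx t hp),
        hM _ (hmem hx t (mem_ball_self (half_pos hδ)))]
    have h2 : ‖(fderiv ℂ h (x, circleMap c r t)).comp (ContinuousLinearMap.inl ℂ E ℂ)‖
        ≤ 2 * M / (δ / 2) := by
      refine (ContinuousLinearMap.opNorm_comp_le _ _).trans ?_
      nlinarith [ContinuousLinearMap.norm_inl_le_one ℂ E ℂ,
        norm_nonneg (fderiv ℂ h (x, circleMap c r t))]
    rw [norm_smul, deriv_circleMap]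
    simp only [norm_mul, norm_I, norm_circleMap_zero, abs_of_nonneg hr, mul_one]
    gcongr
  · exact intervalIntegrable_const
  · refine .of_forall fun t _ x hx => ?_
    have h1 : HasFDerivAt (fun y : E => (y, circleMap c r t)) (ContinuousLinearMap.inl ℂ E ℂ) x :=
      hasFDerivAt_prodMk_left x _
    exact (((hdiff hx t).hasFDerivAt).comp x h1).fun_const_smul _

section Shell

variable {Z W : Type*} [NormedAddCommGroup Z] [NormedSpace ℂ Z]
  [NormedAddCommGroup W] [InnerProductSpace ℂ W]

/-- The component of `w` orthogonal to the unit vector `e`. -/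
noncomputable def orthPart (e w : W) : W := w - inner ℂ e w • e

/-- Replace the `e`-coordinate of `w` by `ζ`. -/
noncomputable def replaceCoord (e w : W) (ζ : ℂ) : W := ζ • e + orthPart e w

theorem replaceCoord_inner (e w : W) : replaceCoord e w (inner ℂ e w) = w := by
  simp [replaceCoord, orthPart]

theorem inner_orthPart {e : W} (he : ‖e‖ = 1) (w : W) : inner ℂ e (orthPart e w) = 0 := by
  simp [orthPart, inner_self_eq_norm_sq_to_K, he]

theorem norm_sq_replaceCoord {e : W} (he : ‖e‖ = 1) (w : W) (ζ : ℂ) :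
    ‖replaceCoord e w ζ‖ ^ 2 = ‖ζ‖ ^ 2 + ‖orthPart e w‖ ^ 2 := by
  have h := norm_add_sq_eq_norm_sq_add_norm_sq_of_inner_eq_zero (𝕜 := ℂ) (ζ • e) (orthPart e w)
    (by rw [inner_smul_left, inner_orthPart he, mul_zero])
  rw [norm_smul, he, mul_one] at h
  simpa [replaceCoord, sq] using h

theorem norm_sq_eq_inner_add_orthPart {e : W} (he : ‖e‖ = 1) (w : W) :
    ‖w‖ ^ 2 = ‖(inner ℂ e w : ℂ)‖ ^ 2 + ‖orthPart e w‖ ^ 2 := by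
  simpa only [replaceCoord_inner] using norm_sq_replaceCoord he w (inner ℂ e w)

theorem differentiable_orthPart (e : W) : Differentiable ℂ (orthPart e) := by
  have : Differentiable ℂ fun w : W => (inner ℂ e w : ℂ) := (innerSL ℂ e).differentiable
  unfold orthPart
  fun_prop

/-- The circle of radius `r` in the complex line through `w` in direction `e` lies in the shell
`b < ‖·‖ < a` and encloses `w`. -/
def IsShellRadius (e : W) (b a : ℝ) (w : W) (r : ℝ) : Prop :=
  ‖(inner ℂ e w : ℂ)‖ < r ∧ b ^ 2 < r ^ 2 + ‖orthPart e w‖ ^ 2 ∧ r ^ 2 + ‖orthPart e w‖ ^ 2 < a ^ 2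

theorem exists_isShellRadius {e : W} (he : ‖e‖ = 1) {b a : ℝ} (hb : 0 ≤ b) (hba : b < a) {w : W}
    (hw : ‖w‖ < a) : ∃ r, IsShellRadius e b a w r := by
  have h1 := norm_sq_eq_inner_add_orthPart he w
  have h2 : max (‖(inner ℂ e w : ℂ)‖ ^ 2) (b ^ 2 - ‖orthPart e w‖ ^ 2)
      < a ^ 2 - ‖orthPart e w‖ ^ 2 := by
    refine max_lt ?_ ?_ <;> nlinarith [norm_nonneg w]
  obtain ⟨s, hs, hsa⟩ := exists_between h2
  obtain ⟨hs1, hs2⟩ := max_lt_iff.1 hs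
  have hs0 : √s ^ 2 = s := Real.sq_sqrt ((sq_nonneg _).trans hs1.le)
  exact ⟨√s, Real.lt_sqrt_of_sq_lt hs1, by linarith, by linarith⟩

theorem IsShellRadius.eventually {e : W} {b a : ℝ} {w : W} {r : ℝ}
    (h : IsShellRadius e b a w r) : ∀ᶠ v in 𝓝 w, IsShellRadius e b a v r := by
  have h1 : Continuous (orthPart e) := (differentiable_orthPart e).continuous
  refine ((Continuous.tendsto ?_ w).eventually (gt_mem_nhds h.1)).and
    (((Continuous.tendsto ?_ w).eventually (lt_mem_nhds h.2.1)).and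
    ((Continuous.tendsto ?_ w).eventually (gt_mem_nhds h.2.2))) <;> fun_prop

/-- The Cauchy kernel of `f` along the complex lines in direction `e`. -/
noncomputable def shellKernel (f : Z × W → ℂ) (e : W) (p : (Z × W) × ℂ) : ℂ :=
  (p.2 - inner ℂ e p.1.2)⁻¹ • f (p.1.1, replaceCoord e p.1.2 p.2)

/-- The Cauchy integral of `f` over the circle of radius `r` in direction `e`. -/
noncomputable def shellIntegral (f : Z × W → ℂ) (e : W) (r : ℝ) (x : Z × W) : ℂ :=
  (2 * Real.pi * I : ℂ)⁻¹ • ∮ ζ in C(0, r), shellKernel f e (x, ζ)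

variable {f : Z × W → ℂ} {S : Set Z} {b a : ℝ} {e : W}

theorem differentiableAt_shellKernel
    (hf : ∀ p : Z × W, p.1 ∈ S → b < ‖p.2‖ → ‖p.2‖ < a → DifferentiableAt ℂ f p)
    {p : (Z × W) × ℂ} (hS : p.1.1 ∈ S) (hp : p.2 ≠ inner ℂ e p.1.2)
    (hpb : b < ‖replaceCoord e p.1.2 p.2‖) (hpa : ‖replaceCoord e p.1.2 p.2‖ < a) :
    DifferentiableAt ℂ (shellKernel f e) p := by
  have h1 : Differentiable ℂ fun w : W => (inner ℂ e w : ℂ) := (innerSL ℂ e).differentiable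
  have h2 := differentiable_orthPart e
  have h3 : DifferentiableAt ℂ
      (fun p : (Z × W) × ℂ => f (p.1.1, replaceCoord e p.1.2 p.2)) p := by
    refine (hf (p.1.1, replaceCoord e p.1.2 p.2) hS hpb hpa).comp
      (f := fun p : (Z × W) × ℂ => (p.1.1, replaceCoord e p.1.2 p.2)) p ?_
    unfold replaceCoord
    fun_prop
  have h4 : DifferentiableAt ℂ (fun p : (Z × W) × ℂ => (p.2 - inner ℂ e p.1.2)⁻¹) p :=
    DifferentiableAt.fun_inv (by fun_prop) (sub_ne_zero.2 hp)
  exact h4.smul h3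

theorem shell_bounds_of_sq (he : ‖e‖ = 1) (ha : 0 < a) {w : W} {ζ : ℂ}
    (h1 : b ^ 2 < ‖ζ‖ ^ 2 + ‖orthPart e w‖ ^ 2) (h2 : ‖ζ‖ ^ 2 + ‖orthPart e w‖ ^ 2 < a ^ 2) :
    b < ‖replaceCoord e w ζ‖ ∧ ‖replaceCoord e w ζ‖ < a := by
  rw [← norm_sq_replaceCoord he] at h1 h2
  exact ⟨lt_of_pow_lt_pow_left₀ 2 (norm_nonneg _) h1, lt_of_pow_lt_pow_left₀ 2 ha.le h2⟩

theorem differentiableAt_shellIntegral [FiniteDimensional ℂ Z] [FiniteDimensional ℂ W]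
    (hS : IsOpen S) (he : ‖e‖ = 1) (ha : 0 < a)
    (hf : ∀ p : Z × W, p.1 ∈ S → b < ‖p.2‖ → ‖p.2‖ < a → DifferentiableAt ℂ f p)
    {x : Z × W} (hx : x.1 ∈ S) {r : ℝ} (hr : IsShellRadius e b a x.2 r) :
    DifferentiableAt ℂ (shellIntegral f e r) x := by
  unfold shellIntegral
  refine DifferentiableAt.fun_const_smul (R := ℂ) ?_ _
  have hc : Continuous fun p : (Z × W) × ℂ => replaceCoord e p.1.2 p.2 := by
    have := (differentiable_orthPart e).continuous
    unfold replaceCoord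
    fun_prop
  refine differentiableAt_circleIntegral_of_differentiableOn
    (U := {p | p.1.1 ∈ S ∧ p.2 ≠ inner ℂ e p.1.2 ∧ b < ‖replaceCoord e p.1.2 p.2‖ ∧
      ‖replaceCoord e p.1.2 p.2‖ < a}) ?_ ?_ ((norm_nonneg _).trans hr.1.le) ?_
  · exact (hS.preimage (by fun_prop)).inter ((isOpen_ne_fun (by fun_prop) (by fun_prop)).inter
      ((isOpen_lt continuous_const hc.norm).inter (isOpen_lt hc.norm continuous_const)))
  · rintro p ⟨h1, h2, h3, h4⟩
    exact (differentiableAt_shellKernel hf h1 h2 h3 h4).differentiableWithinAt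
  · intro ζ hζ
    rw [mem_sphere_zero_iff_norm] at hζ
    refine ⟨hx, ?_, shell_bounds_of_sq he ha (hζ ▸ hr.2.1) (hζ ▸ hr.2.2)⟩
    intro (h : ζ = inner ℂ e x.2)
    exact hr.1.ne (h ▸ hζ)

theorem shellIntegral_eq_of_le (he : ‖e‖ = 1) (ha : 0 < a)
    (hf : ∀ p : Z × W, p.1 ∈ S → b < ‖p.2‖ → ‖p.2‖ < a → DifferentiableAt ℂ f p)
    {x : Z × W} (hx : x.1 ∈ S) {r R : ℝ} (hr : IsShellRadius e b a x.2 r)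
    (hR : IsShellRadius e b a x.2 R) (hrR : r ≤ R) :
    shellIntegral f e R x = shellIntegral f e r x := by
  have hr0 : 0 < r := (norm_nonneg _).trans_lt hr.1
  have hd {ζ : ℂ} (h1 : r ≤ ‖ζ‖) (h2 : ‖ζ‖ ≤ R) :
      DifferentiableAt ℂ (fun ζ => shellKernel f e (x, ζ)) ζ := by
    have h3 := shell_bounds_of_sq (ζ := ζ) (w := x.2) he ha
      (hr.2.1.trans_le (by gcongr)) (lt_of_le_of_lt (by gcongr) hR.2.2)
    have h4 : ζ ≠ inner ℂ e x.2 := by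
      rintro rfl
      exact (hr.1.trans_le h1).false
    exact (differentiableAt_shellKernel (p := (x, ζ)) hf hx h4 h3.1 h3.2).comp
      (f := fun ζ : ℂ => (x, ζ)) ζ (by fun_prop)
  unfold shellIntegral
  congr 1
  refine circleIntegral_eq_of_differentiable_on_annulus_off_countable hr0 hrR countable_empty ?_ ?_
  · rintro ζ ⟨h1, h2⟩
    exact (hd (by simpa using h2) (by simpa using h1)).continuousAt.continuousWithinAt
  · rintro ζ ⟨⟨h1, h2⟩, -⟩
    rw [mem_closedBall_zero_iff, not_le] at h2
    exact hd h2.le (mem_ball_zero_iff.1 h1).le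

theorem shellIntegral_eq (he : ‖e‖ = 1) (ha : 0 < a)
    (hf : ∀ p : Z × W, p.1 ∈ S → b < ‖p.2‖ → ‖p.2‖ < a → DifferentiableAt ℂ f p)
    {x : Z × W} (hx : x.1 ∈ S) {r R : ℝ} (hr : IsShellRadius e b a x.2 r)
    (hR : IsShellRadius e b a x.2 R) :
    shellIntegral f e R x = shellIntegral f e r x := by
  rcases le_total r R with h | h
  · exact shellIntegral_eq_of_le he ha hf hx hr hR h
  · exact (shellIntegral_eq_of_le he ha hf hx hR hr h).symm

/-- Where the whole disc in direction `e` avoids the inner ball, Cauchy's formula applies. -/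
theorem shellIntegral_eq_self (he : ‖e‖ = 1) (hb : 0 ≤ b) (ha : 0 < a)
    (hf : ∀ p : Z × W, p.1 ∈ S → b < ‖p.2‖ → ‖p.2‖ < a → DifferentiableAt ℂ f p)
    {x : Z × W} (hx : x.1 ∈ S) {r : ℝ} (hr : IsShellRadius e b a x.2 r)
    (hxb : b < ‖orthPart e x.2‖) :
    shellIntegral f e r x = f x := by
  have hd : DifferentiableOn ℂ (fun ζ => f (x.1, replaceCoord e x.2 ζ)) (closedBall 0 r) := by
    intro ζ hζ
    rw [mem_closedBall_zero_iff] at hζ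
    have h3 := shell_bounds_of_sq (ζ := ζ) (w := x.2) (b := b) he ha
      (by nlinarith [sq_nonneg ‖ζ‖]) (lt_of_le_of_lt (by gcongr) hr.2.2)
    refine DifferentiableAt.differentiableWithinAt ?_
    refine (hf (x.1, replaceCoord e x.2 ζ) hx h3.1 h3.2).comp
      (f := fun ζ : ℂ => (x.1, replaceCoord e x.2 ζ)) ζ ?_
    unfold replaceCoord
    fun_prop
  have h := hd.circleIntegral_sub_inv_smul (w := inner ℂ e x.2) (by simpa using hr.1)
  have h0 : (2 * Real.pi * I : ℂ) ≠ 0 := two_pi_I_ne_zero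
  simp only [shellIntegral, shellKernel, h, replaceCoord_inner]
  rw [smul_smul, inv_mul_cancel₀ h0, one_smul]

/-- Every vector lies on a great circle through a vector orthogonal to `e`. -/
theorem exists_orthonormal_cos_sin (he : ‖e‖ = 1) {e' : W} (he' : ‖e'‖ = 1)
    (hee' : inner ℂ e e' = 0) (w : W) : ∃ (A B : W) (t : ℝ), ‖A‖ = 1 ∧ ‖B‖ = 1 ∧
      inner ℂ A B = 0 ∧  orthPart e B = B ∧
      w = (‖w‖ : ℂ) • (cos t • A + sin t • B) := by
  obtain ⟨u, hu, hu'⟩ : ∃ u : ℂ, ‖u‖ = 1 ∧ inner ℂ e w = (‖(inner ℂ e w : ℂ)‖ : ℂ) * u := by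
    by_cases h : (inner ℂ e w : ℂ) = 0
    · exact ⟨1, by simp, by simp [h]⟩
    · have h' : (‖(inner ℂ e w : ℂ)‖ : ℂ) ≠ 0 := by simpa using h
      exact ⟨inner ℂ e w / ‖(inner ℂ e w : ℂ)‖, by simp [h], by field_simp⟩
  obtain ⟨B, hB, heB, hB'⟩ : ∃ B : W, ‖B‖ = 1 ∧ inner ℂ e B = 0 ∧
      orthPart e w = (‖orthPart e w‖ : ℂ) • B := by
    by_cases h : orthPart e w = 0
    · exact ⟨e', he', hee', by simp [h]⟩
    · have h' : (‖orthPart e w‖ : ℂ) ≠ 0 := by simpa using h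
      refine ⟨(‖orthPart e w‖ : ℂ)⁻¹ • orthPart e w, by simp [norm_smul, h], ?_, ?_⟩
      · rw [inner_smul_right, inner_orthPart he, mul_zero]
      · rw [smul_smul, mul_inv_cancel₀ h', one_smul]
  set z : ℂ := ⟨‖(inner ℂ e w : ℂ)‖, ‖orthPart e w‖⟩
  have hzw : ‖z‖ = ‖w‖ := by
    rw [← sq_eq_sq₀ (norm_nonneg _) (norm_nonneg _), norm_sq_eq_inner_add_orthPart he w,
      Complex.sq_norm, normSq_mk]
    ring
  have hcos : (‖w‖ : ℂ) * cos z.arg = ‖(inner ℂ e w : ℂ)‖ := by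
    rw [← hzw]
    exact_mod_cast norm_mul_cos_arg z
  have hsin : (‖w‖ : ℂ) * sin z.arg = ‖orthPart e w‖ := by
    rw [← hzw]
    exact_mod_cast norm_mul_sin_arg z
  refine ⟨u • e, B, z.arg, by simp [norm_smul, hu, he], hB, by simp [heB], ?_, ?_⟩
  · simp [orthPart, heB]
  · rw [smul_add, smul_smul, smul_smul, smul_smul, hcos, hsin, ← hB', ← hu']
    exact (replaceCoord_inner e w).symm

theorem norm_cos_smul_add_sin_smul {A B : W} (hA : ‖A‖ = 1) (hB : ‖B‖ = 1)
    (hAB : inner ℂ A B = 0) (t : ℝ) : ‖cos (t : ℂ) • A + sin (t : ℂ) • B‖ = 1 := by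
  have h := norm_add_sq_eq_norm_sq_add_norm_sq_of_inner_eq_zero (𝕜 := ℂ)
    (cos (t : ℂ) • A) (sin (t : ℂ) • B) (by simp [inner_smul_left, inner_smul_right, hAB])
  rw [norm_smul, norm_smul, hA, hB, ← ofReal_cos, ← ofReal_sin, norm_real, norm_real] at h
  simp only [mul_one, Real.norm_eq_abs, abs_mul_abs_self] at h
  rw [← ofReal_cos, ← ofReal_sin, ← sq_eq_sq₀ (norm_nonneg _) zero_le_one]
  nlinarith [Real.sin_sq_add_cos_sq t]

/-- Two functions holomorphic on the shell that agree where the component orthogonal to `e` is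
large agree on the whole shell. -/
theorem eq_of_eq_of_lt_norm_orthPart {f g : W → ℂ}
    (hf : ∀ w : W, b < ‖w‖ → ‖w‖ < a → DifferentiableAt ℂ f w)
    (hg : ∀ w : W, b < ‖w‖ → ‖w‖ < a → DifferentiableAt ℂ g w)
    (he : ‖e‖ = 1) {e' : W} (he' : ‖e'‖ = 1) (hee' : inner ℂ e e' = 0)
    (hfg : ∀ w : W, ‖w‖ < a → b < ‖orthPart e w‖ → f w = g w)
    {w : W} (hwb : b < ‖w‖) (hwa : ‖w‖ < a) : f w = g w := by
  obtain ⟨A, B, t, hA, hB, hAB, hB', hw⟩ := exists_orthonormal_cos_sin he he' hee' w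
  set γ : ℂ → W := fun s => (‖w‖ : ℂ) • (cos s • A + sin s • B) with hγ
  have hγd : Differentiable ℂ γ := by fun_prop
  have hγn (s : ℝ) : ‖γ s‖ = ‖w‖ := by
    rw [hγ, norm_smul, norm_cos_smul_add_sin_smul hA hB hAB s, mul_one, norm_real, norm_norm]
  have hev (s : ℝ) : ∀ᶠ v in 𝓝 (s : ℂ), b < ‖γ v‖ ∧ ‖γ v‖ < a := by
    have hc : Tendsto (fun v => ‖γ v‖) (𝓝 (s : ℂ)) (𝓝 ‖w‖) :=
      hγn s ▸ (hγd.continuous.norm.tendsto (s : ℂ))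
    exact (hc.eventually (lt_mem_nhds hwb)).and (hc.eventually (gt_mem_nhds hwa))
  have han {k : W → ℂ} (hk : ∀ w : W, b < ‖w‖ → ‖w‖ < a → DifferentiableAt ℂ k w) :
      AnalyticOnNhd ℝ (fun s : ℝ => k (γ s)) univ := by
    intro s _
    have h1 : AnalyticAt ℂ (k ∘ γ) (s : ℂ) := by
      rw [analyticAt_iff_eventually_differentiableAt]
      filter_upwards [hev s] with v hv
      exact (hk _ hv.1 hv.2).comp v (hγd v)
    exact h1.restrictScalars.comp (ofRealCLM.analyticAt s)
  have hloc : (fun s : ℝ => f (γ s)) =ᶠ[𝓝 (Real.pi / 2)] fun s => g (γ s) := by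
    have hc : Continuous fun s : ℝ => ‖orthPart e (γ s)‖ :=
      ((differentiable_orthPart e).continuous.comp (hγd.continuous.comp continuous_ofReal)).norm
    have h1 : ‖orthPart e (γ (Real.pi / 2 : ℝ))‖ = ‖w‖ := by
      have : γ (Real.pi / 2 : ℝ) = (‖w‖ : ℂ) • B := by simp [hγ]
      rw [this, show orthPart e ((‖w‖ : ℂ) • B) = (‖w‖ : ℂ) • orthPart e B by
        simp [orthPart, smul_sub, smul_smul], hB']
      simp [norm_smul, hB]
    filter_upwards [(hc.tendsto (Real.pi / 2)).eventually (lt_mem_nhds (h1 ▸ hwb))] with s hs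
    exact hfg _ ((hγn s).trans_lt hwa) hs
  have := congrFun ((han hf).eq_of_eventuallyEq (han hg) hloc) t
  rwa [show γ t = w from hw.symm] at this

/-- **Hartogs extension** across the inner ball of a spherical shell, with holomorphic dependence
on a parameter. -/
theorem exists_differentiable_extension_of_shell [FiniteDimensional ℂ Z] [FiniteDimensional ℂ W]
    (hS : IsOpen S) (hb : 0 ≤ b) (hba : b < a)
    (hf : ∀ p : Z × W, p.1 ∈ S → b < ‖p.2‖ → ‖p.2‖ < a → DifferentiableAt ℂ f p)
    (he : ‖e‖ = 1) {e' : W} (he' : ‖e'‖ = 1) (hee' : inner ℂ e e' = 0) :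
    ∃ F : Z × W → ℂ, (∀ p : Z × W, p.1 ∈ S → ‖p.2‖ < a → DifferentiableAt ℂ F p) ∧
      ∀ p : Z × W, p.1 ∈ S → b < ‖p.2‖ → ‖p.2‖ < a → F p = f p := by
  have ha : 0 < a := hb.trans_lt hba
  choose! ρ hρ using fun w (hw : ‖w‖ < a) => exists_isShellRadius he hb hba hw
  have hF (p : Z × W) (hpS : p.1 ∈ S) (hpa : ‖p.2‖ < a) :
      DifferentiableAt ℂ (fun x => shellIntegral f e (ρ x.2) x) p := by
    refine (differentiableAt_shellIntegral hS he ha hf hpS (hρ _ hpa)).congr_of_eventuallyEq ?_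
    filter_upwards [continuous_fst.continuousAt.eventually (hS.mem_nhds hpS),
      (continuous_norm.comp continuous_snd).continuousAt.eventually (gt_mem_nhds hpa),
      continuous_snd.continuousAt.eventually (hρ _ hpa).eventually] with x hxS hxa hxr
    exact shellIntegral_eq he ha hf hxS hxr (hρ _ hxa)
  refine ⟨_, hF, fun p hpS hpb hpa => ?_⟩
  have hprod (w : W) : DifferentiableAt ℂ (fun w : W => (p.1, w)) w := by fun_prop
  exact eq_of_eq_of_lt_norm_orthPart (f := fun w => shellIntegral f e (ρ w) (p.1, w))
    (g := fun w => f (p.1, w))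
    (fun w _ hwa => (hF (p.1, w) hpS hwa).comp w (hprod w))
    (fun w hwb hwa => (hf (p.1, w) hpS hwb hwa).comp w (hprod w)) he he' hee'
    (fun w hwa hw => shellIntegral_eq_self (x := (p.1, w)) he hb ha hf hpS (hρ w hwa) hw) hpb hpa

end Shell

/-- parametrized Hartogs extension: for `n > q ≥ 2` and `a > 1`,
a function holomorphic on `V(a) ⊆ ℂ^{n-q} × ℂ^q` extends holomorphically to the
polydomain `{‖z‖ < a, ‖w‖ < a}`. -/
theorem statement4 (n q : ℕ) (hq : 2 ≤ q) (hqn : q < n) (a : ℝ) (ha : 1 < a)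
    (f : Esp n q → ℂ)
    (hf : ∀ p ∈ Vdom n q a, DifferentiableAt ℂ f p) :
    ∃ F : Esp n q → ℂ,
      (∀ p : Esp n q, ‖p.1‖ < a → ‖p.2‖ < a → DifferentiableAt ℂ F p) ∧
      (∀ p ∈ Vdom n q a, F p = f p) := by
  have ho := EuclideanSpace.orthonormal_single (𝕜 := ℂ) (ι := Fin q)
  obtain ⟨F, hF, hFf⟩ := exists_differentiable_extension_of_shell (f := f)
    (S := {z | ‖z‖ < a}) (b := a⁻¹) (isOpen_lt continuous_norm continuous_const)
    (by positivity) ((inv_lt_one_of_one_lt₀ ha).trans ha) (fun p h1 h2 h3 => hf p ⟨h1, h2, h3⟩)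
    (ho.1 ⟨0, by omega⟩) (ho.1 ⟨1, by omega⟩) (ho.2 (by simp))
  exact ⟨F, hF, fun p hp => hFf p hp.1 hp.2.1 hp.2.2⟩
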